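/- Let k ≥ 1, v = 2k, R = F_2[U, U^{-1}], and let M be the free R-module with basis {a, b, c, e, z_0} ∪ {z_r^s : 1 ≤ r ≤ v, s ∈ {1,2}}, with R-linear differential ∂ given by ∂a = b + c, ∂b = ∂c = U·e, ∂z_1^s = z_0 + z_2^s, ∂z_r^s = z_{r-1}^s + z_{r+1}^s for odd r with 1 < r ≤ v-1, and ∂ = 0 on e, z_0, and z_r^s for even r. Define the R-linear map ι : M → M by ι(a) = a + z_0, ι(b) = c, ι(c) = b, ι(e) = e, ι(z_0) = z_0 + e, ι(z_1^1) = z_1^2 + U^{-1}·c, ι(z_1^2) = z_1^1 + U^{-1}·b, and ι(z_r^1) = z_r^2, ι(z_r^2) = z_r^1 for 2 ≤ r ≤ v. Then ι ∘ ∂ = ∂ ∘ ι, and ι ∘ ι = σ, where σ is the R-linear map with σ(a) = a + e and σ fixing all other basis elements. -/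

import Mathlib

/- On the dual model complex C̄₁, the involution ι is a chain map and squares to the
Sarkar involution σ. -/

open LaurentPolynomial

/-- `R2` is the Laurent polynomial ring `F₂[U, U⁻¹]`. -/
abbrev R2 : Type := LaurentPolynomial (ZMod 2)

/-- The variable `U`. -/
noncomputable def U : R2 := T 1

/-- Its inverse `U⁻¹`. -/
noncomputable def Uinv : R2 := T (-1)

/-- Basis `{a, b, c, e, z_0} ∪ {z_r^s : 1 ≤ r ≤ v, s ∈ {1,2}}` of the dual model complex
`C̄₁` (with `z s r` for `s : Fin 2`, `r : Fin v` standing for `z_{r+1}^{s+1}`). -/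
inductive ModelB (v : ℕ) : Type
  | a | b | c | e | z0 | z (s : Fin 2) (r : Fin v)
  deriving DecidableEq

/-- The basis vector `z_r^{s+1}` for `1 ≤ r ≤ v`, extended by `0` outside that range. -/
noncomputable def zS (v : ℕ) (s : Fin 2) (r : ℕ) : ModelB v → R2 :=
  if h : 1 ≤ r ∧ r ≤ v then Pi.single (ModelB.z s ⟨r - 1, by omega⟩) 1 else 0

instance ModelB.instFinite (v : ℕ) : Finite (ModelB v) := by
  refine Finite.of_surjective
    (fun x : Fin 5 ⊕ Fin 2 × Fin v => Sum.elim ![a, b, c, e, z0] (fun p => z p.1 p.2) x) ?_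
  rintro (_ | _ | _ | _ | _ | ⟨s, r⟩)
  exacts [⟨.inl 0, rfl⟩, ⟨.inl 1, rfl⟩, ⟨.inl 2, rfl⟩, ⟨.inl 3, rfl⟩, ⟨.inl 4, rfl⟩,
    ⟨.inr (s, r), rfl⟩]

/-- Linear maps out of the model complex agree if they agree on the basis. -/
theorem ModelB.linearMap_ext {v : ℕ} {f g : (ModelB v → R2) →ₗ[R2] (ModelB v → R2)}
    (ha : f (Pi.single a 1) = g (Pi.single a 1)) (hb : f (Pi.single b 1) = g (Pi.single b 1))
    (hc : f (Pi.single c 1) = g (Pi.single c 1)) (he : f (Pi.single e 1) = g (Pi.single e 1))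
    (hz0 : f (Pi.single z0 1) = g (Pi.single z0 1))
    (hz : ∀ s r, 1 ≤ r → r ≤ v → f (zS v s r) = g (zS v s r)) : f = g := by
  refine LinearMap.pi_ext' fun i => LinearMap.ext_ring ?_
  obtain _ | _ | _ | _ | _ | ⟨s, r⟩ := i
  · exact ha
  · exact hb
  · exact hc
  · exact he
  · exact hz0
  · have h : zS v s (r + 1) = Pi.single (z s r) 1 := dif_pos ⟨by omega, r.2⟩
    have hr := hz s (r + 1) (by omega) r.2
    rw [h] at hr
    exact hr

theorem Uinv_mul_U : Uinv * U = 1 := by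
  rw [Uinv, U, ← T_add, neg_add_cancel, T_zero]

theorem modelB_add_self {v : ℕ} (x : ModelB v → R2) : x + x = 0 := by
  have h : (2 : R2) = 0 := by
    rw [← map_ofNat (C : ZMod 2 →+* R2) 2, show (OfNat.ofNat 2 : ZMod 2) = 0 from rfl, map_zero]
  rw [← two_smul R2, h, zero_smul]

/-- On the dual model complex `C̄₁` (free `R2`-module on `{a,b,c,e,z_0} ∪ {z_r^s}` with the
stated differential `∂`), the map `ι` with `ι a = a + z_0`, `ι b = c`, `ι c = b`, `ι e = e`,
`ι z_0 = z_0 + e`, `ι z_1^1 = z_1^2 + U⁻¹ • c`, `ι z_1^2 = z_1^1 + U⁻¹ • b`, and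
`ι z_r^1 = z_r^2`, `ι z_r^2 = z_r^1` for `2 ≤ r ≤ v`, satisfies `ι ∘ ∂ = ∂ ∘ ι` and
`ι ∘ ι = σ`, where `σ` is the Sarkar involution sending `a` to `a + e` and fixing all
other basis elements. -/
theorem modelC1dual_involution (k : ℕ) (hk : 1 ≤ k) (v : ℕ) (hv : v = 2 * k)
    (d ι σ : (ModelB v → R2) →ₗ[R2] (ModelB v → R2))
    -- the differential ∂ = d
    (hda : d (Pi.single ModelB.a 1) = Pi.single ModelB.b 1 + Pi.single ModelB.c 1)
    (hdb : d (Pi.single ModelB.b 1) = U • (Pi.single ModelB.e 1 : ModelB v → R2))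
    (hdc : d (Pi.single ModelB.c 1) = U • (Pi.single ModelB.e 1 : ModelB v → R2))
    (hdz1 : ∀ s : Fin 2, d (zS v s 1) = Pi.single ModelB.z0 1 + zS v s 2)
    (hdzodd : ∀ s : Fin 2, ∀ r : ℕ, 1 < r → r ≤ v - 1 → Odd r →
      d (zS v s r) = zS v s (r - 1) + zS v s (r + 1))
    (hde : d (Pi.single ModelB.e 1) = 0)
    (hdz0 : d (Pi.single ModelB.z0 1) = 0)
    (hdzeven : ∀ s : Fin 2, ∀ r : ℕ, 1 ≤ r → r ≤ v → Even r → d (zS v s r) = 0)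
    -- the involution ι
    (hia : ι (Pi.single ModelB.a 1) = Pi.single ModelB.a 1 + Pi.single ModelB.z0 1)
    (hib : ι (Pi.single ModelB.b 1) = Pi.single ModelB.c 1)
    (hic : ι (Pi.single ModelB.c 1) = Pi.single ModelB.b 1)
    (hie : ι (Pi.single ModelB.e 1) = Pi.single ModelB.e 1)
    (hiz0 : ι (Pi.single ModelB.z0 1) = Pi.single ModelB.z0 1 + Pi.single ModelB.e 1)
    (hiz11 : ι (zS v 0 1) = zS v 1 1 + Uinv • (Pi.single ModelB.c 1 : ModelB v → R2))
    (hiz12 : ι (zS v 1 1) = zS v 0 1 + Uinv • (Pi.single ModelB.b 1 : ModelB v → R2))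
    (hiz : ∀ r : ℕ, 2 ≤ r → r ≤ v → ι (zS v 0 r) = zS v 1 r ∧ ι (zS v 1 r) = zS v 0 r)
    -- the Sarkar involution σ
    (hsa : σ (Pi.single ModelB.a 1) = Pi.single ModelB.a 1 + Pi.single ModelB.e 1)
    (hsb : σ (Pi.single ModelB.b 1) = Pi.single ModelB.b 1)
    (hsc : σ (Pi.single ModelB.c 1) = Pi.single ModelB.c 1)
    (hse : σ (Pi.single ModelB.e 1) = Pi.single ModelB.e 1)
    (hsz0 : σ (Pi.single ModelB.z0 1) = Pi.single ModelB.z0 1)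
    (hsz : ∀ s : Fin 2, ∀ r : ℕ, 1 ≤ r → r ≤ v → σ (zS v s r) = zS v s r) :
    ι ∘ₗ d = d ∘ₗ ι ∧ ι ∘ₗ ι = σ := by
  refine ⟨ModelB.linearMap_ext ?_ ?_ ?_ ?_ ?_ ?_, ModelB.linearMap_ext ?_ ?_ ?_ ?_ ?_ ?_⟩ <;>
    simp only [LinearMap.comp_apply]
  · simp only [hda, hia, map_add, hib, hic, hdz0]
    abel
  · simp only [hdb, hib, hdc, map_smul, hie]
  · simp only [hdb, hic, hdc, map_smul, hie]
  · simp only [hde, hie, map_zero]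
  · simp only [hdz0, hiz0, map_add, hde, map_zero, add_zero]
  · intro s r h1 hr
    obtain rfl | h2 : r = 1 ∨ 2 ≤ r := by omega
    · obtain ⟨h20, h21⟩ := hiz 2 le_rfl (by omega)
      fin_cases s
      · simp only [Fin.zero_eta, hdz1, hiz11, map_add, map_smul, hiz0, h20, hdc, smul_smul,
          Uinv_mul_U, one_smul]
        abel
      · simp only [Fin.mk_one, hdz1, hiz12, map_add, map_smul, hiz0, h21, hdb, smul_smul,
          Uinv_mul_U, one_smul]
        abel
    · obtain ⟨h0, h1'⟩ := hiz r h2 hr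
      obtain hev | hodd := Nat.even_or_odd r
      · fin_cases s <;>
          simp only [Fin.zero_eta, Fin.mk_one, h0, h1', hdzeven _ r h1 hr hev, map_zero]
      · have hr' : r ≤ v - 1 := by grind
        obtain ⟨hp0, hp1⟩ := hiz (r - 1) (by grind) (by omega)
        obtain ⟨hs0, hs1⟩ := hiz (r + 1) (by omega) (by omega)
        fin_cases s <;>
          simp only [Fin.zero_eta, Fin.mk_one, h0, h1', hdzodd _ r h2 hr' hodd, map_add,
            hp0, hp1, hs0, hs1]
  · rw [hia, map_add, hia, hiz0, hsa, add_assoc, ← add_assoc (Pi.single ModelB.z0 1),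
      modelB_add_self, zero_add]
  · rw [hib, hic, hsb]
  · rw [hic, hib, hsc]
  · rw [hie, hie, hse]
  · rw [hiz0, map_add, hiz0, hie, hsz0, add_assoc, modelB_add_self, add_zero]
  · intro s r h1 hr
    rw [hsz s r h1 hr]
    obtain rfl | h2 : r = 1 ∨ 2 ≤ r := by omega
    · fin_cases s
      · simp only [Fin.zero_eta, hiz11, map_add, map_smul, hiz12, hic, add_assoc,
          modelB_add_self, add_zero]
      · simp only [Fin.mk_one, hiz11, map_add, map_smul, hiz12, hib, add_assoc,
          modelB_add_self, add_zero]
    · obtain ⟨h0, h1'⟩ := hiz r h2 hr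
      fin_cases s <;> simp only [Fin.zero_eta, Fin.mk_one, h0, h1']
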